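/- Let G be a countable group and ρ : G → Homeo₊(S¹) a homomorphism. Let x ∈ S¹ have trivial stabilizer under ρ, and let (xᵢ) be a sequence in S¹ converging to x such that each xᵢ has trivial stabilizer. Let c be the circular order on G induced by the orbit of x and cᵢ the circular order induced by the orbit of xᵢ. Then cᵢ converges to c in CO(G): for every finite set S ⊆ G there exists N such that cᵢ(g,h,k) = c(g,h,k) for all g,h,k ∈ S and all i ≥ N. -/

import Mathlib

noncomputable section

open Classical in
/-- The circle `ℝ/ℤ`. -/
abbrev S1 : Type := AddCircle (1 : ℝ)

/-- The canonical representative of a point of the circle in `[0,1)`. -/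
noncomputable def S1.rep (x : S1) : ℝ := (AddCircle.equivIco 1 0 x : ℝ)

open Classical in
/-- The orientation cocycle on the circle: `1` on positively oriented (counterclockwise)
triples of pairwise distinct points, `-1` on negatively oriented ones, `0` otherwise. -/
noncomputable def circOrd (x y z : S1) : ℤ :=
  if x = y ∨ y = z ∨ x = z then 0
  else if (S1.rep x < S1.rep y ∧ S1.rep y < S1.rep z) ∨
      (S1.rep y < S1.rep z ∧ S1.rep z < S1.rep x) ∨
      (S1.rep z < S1.rep x ∧ S1.rep x < S1.rep y) then 1 else -1

/-- The group `Homeo₊(S¹)` of orientation preserving homeomorphisms of the circle, realized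
as the subgroup of bijections of `S¹` which are homeomorphisms and preserve the orientation
cocycle. -/
noncomputable def HomeoPos : Subgroup (Equiv.Perm S1) where
  carrier := {f | Continuous f ∧ Continuous f.symm ∧
    ∀ x y z, circOrd (f x) (f y) (f z) = circOrd x y z}
  one_mem' := ⟨by simpa using continuous_id, by exact (continuous_id : Continuous (id : S1 → S1)), by simp⟩
  mul_mem' := by
    rintro a b ⟨ha1, ha2, ha3⟩ ⟨hb1, hb2, hb3⟩
    refine ⟨?_, ?_, ?_⟩
    · have : ⇑(a * b) = ⇑a ∘ ⇑b := by ext x; simp [Equiv.Perm.mul_apply]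
      rw [this]; exact ha1.comp hb1
    · have : ⇑(a * b).symm = ⇑b.symm ∘ ⇑a.symm := by
        ext x; rfl
      rw [this]; exact hb2.comp ha2
    · intro x y z
      simp only [Equiv.Perm.mul_apply]
      rw [ha3, hb3]
  inv_mem' := by
    rintro a ⟨ha1, ha2, ha3⟩
    refine ⟨ha2, by exact ha1, ?_⟩
    intro x y z
    have := ha3 (a⁻¹ x) (a⁻¹ y) (a⁻¹ z)
    simpa using this.symm

/-- The action of an element of `Homeo₊(S¹)` on the circle. -/
def ap (h : ↥HomeoPos) (x : S1) : S1 := h.1 x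

lemma ap_one (x : S1) : ap 1 x = x := rfl

lemma ap_mul (h₁ h₂ : ↥HomeoPos) (x : S1) : ap (h₁ * h₂) x = ap h₁ (ap h₂ x) := rfl

variable {G : Type*} [Group G]

/-- A (left-invariant) circular order on a group `G`: a function `G³ → {-1,0,1}` vanishing
exactly on degenerate triples, satisfying the cocycle identity, and left-invariant. -/
def IsCircularOrder (c : G → G → G → ℤ) : Prop :=
  (∀ a b d, c a b d = 0 ↔ a = b ∨ b = d ∨ a = d) ∧
  (∀ a b d, c a b d = 1 ∨ c a b d = 0 ∨ c a b d = -1) ∧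
  (∀ g₁ g₂ g₃ g₄, c g₂ g₃ g₄ - c g₁ g₃ g₄ + c g₁ g₂ g₄ - c g₁ g₂ g₃ = 0) ∧
  (∀ g u v w, c (g * u) (g * v) (g * w) = c u v w)

/-- `c` is an isolated point of the space `CO(G)` of circular orders on `G` (with the
topology induced from the product topology on `{-1,0,1}^{G³}`): some basic neighborhood,
determined by agreement on a finite subset of `G`, contains only `c`. -/
def IsIsolatedCO (c : G → G → G → ℤ) : Prop :=
  ∃ S : Finset G, ∀ c' : G → G → G → ℤ, IsCircularOrder c' →
    (∀ u ∈ S, ∀ v ∈ S, ∀ w ∈ S, c' u v w = c u v w) → c' = c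

/-- The basepoint `x₀` has trivial stabilizer under the action `ρ`. -/
def TrivialStabilizer (ρ : G →* ↥HomeoPos) (x₀ : S1) : Prop :=
  ∀ g : G, ap (ρ g) x₀ = x₀ → g = 1

/-- The circular order on `G` induced by the orbit of a point `x₀` with trivial stabilizer. -/
def inducedCO (ρ : G →* ↥HomeoPos) (x₀ : S1) (g₁ g₂ g₃ : G) : ℤ :=
  circOrd (ap (ρ g₁) x₀) (ap (ρ g₂) x₀) (ap (ρ g₃) x₀)

/-- A continuous degree-one monotone map of the circle: a continuous surjection which
weakly preserves the orientation cocycle. -/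
def DegOneMonotone (f : S1 → S1) : Prop :=
  Continuous f ∧ Function.Surjective f ∧
    ∀ x y z, f x ≠ f y → f y ≠ f z → f x ≠ f z → circOrd (f x) (f y) (f z) = circOrd x y z

/-- `ρ` is a dynamical realization of the circular order `c` with basepoint `x₀`. -/
def IsDynamicalRealization (ρ : G →* ↥HomeoPos) (x₀ : S1) (c : G → G → G → ℤ) : Prop :=
  TrivialStabilizer ρ x₀ ∧
  (∀ g₁ g₂ g₃, inducedCO ρ x₀ g₁ g₂ g₃ = c g₁ g₂ g₃) ∧
  ∀ ρ' : G →* ↥HomeoPos, TrivialStabilizer ρ' x₀ →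
    (∀ g₁ g₂ g₃, inducedCO ρ' x₀ g₁ g₂ g₃ = c g₁ g₂ g₃) →
    ∃ f : S1 → S1, DegOneMonotone f ∧ f x₀ = x₀ ∧
      ∀ g : G, (ap (ρ g)) ∘ f = f ∘ (ap (ρ' g))

end
noncomputable section
variable {G : Type*} [Group G]


lemma rep_mem (y : S1) : 0 ≤ S1.rep y ∧ S1.rep y < 1 := by
  have h := (AddCircle.equivIco 1 0 y).2
  simpa [S1.rep] using h

lemma coe_rep (y : S1) : ((S1.rep y : ℝ) : S1) = y :=
  (AddCircle.equivIco 1 0).symm_apply_apply y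

lemma rep_inj {x y : S1} (h : S1.rep x = S1.rep y) : x = y := by
  rw [← coe_rep x, ← coe_rep y, h]

lemma rep_near (a : S1) (ε : ℝ) (hε : 0 < ε) :
    ∀ᶠ y in nhds a, |S1.rep y - S1.rep a| < ε ∨ (S1.rep a = 0 ∧ 1 - ε < S1.rep y) := by
  by_cases ha : a = ((0 : ℝ) : S1)
  · have h0 : S1.rep a = 0 := by
      rw [ha]
      have := (AddCircle.equivIco 1 0).apply_symm_apply (⟨0, by simp⟩ : Set.Ico (0:ℝ) (0+1))
      exact congrArg Subtype.val this
    have ha' : a = 0 := by simpa using ha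
    filter_upwards [Metric.ball_mem_nhds a hε] with y hy
    rw [ha', Metric.mem_ball, dist_zero_right, ← coe_rep y, AddCircle.norm_eq] at hy
    rw [h0]
    obtain ⟨h1, h2⟩ := rep_mem y
    simp only [inv_one, one_mul, mul_one] at hy
    have hr := abs_lt.1 hy
    have hb := abs_le.1 (abs_sub_round (S1.rep y))
    have e1 : (-1:ℝ) < round (S1.rep y) := by linarith
    have e2 : (round (S1.rep y) : ℝ) < 2 := by linarith
    have e1' : -1 < round (S1.rep y) := by exact_mod_cast e1
    have e2' : round (S1.rep y) < 2 := by exact_mod_cast e2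
    have : round (S1.rep y) = 0 ∨ round (S1.rep y) = 1 := by omega
    rcases this with h | h
    · left; rw [h] at hr; push_cast at hr; rw [abs_lt]; constructor <;> linarith
    · right; rw [h] at hr; push_cast at hr; exact ⟨rfl, by linarith⟩
  · have hc : ContinuousAt S1.rep a :=
      continuous_subtype_val.continuousAt.comp (AddCircle.continuousAt_equivIco 1 0 ha)
    filter_upwards [Metric.tendsto_nhds.1 hc ε hε] with y hy
    exact Or.inl hy

lemma circOrd_near (a b c : S1) (hab : a ≠ b) (hbc : b ≠ c) (hac : a ≠ c) :
    ∀ᶠ p in nhds a ×ˢ (nhds b ×ˢ nhds c), circOrd p.1 p.2.1 p.2.2 = circOrd a b c := by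
  have hab' : S1.rep a ≠ S1.rep b := fun h => hab (rep_inj h)
  have hbc' : S1.rep b ≠ S1.rep c := fun h => hbc (rep_inj h)
  have hac' : S1.rep a ≠ S1.rep c := fun h => hac (rep_inj h)
  have ma := rep_mem a
  have mb := rep_mem b
  have mc := rep_mem c
  obtain ⟨ε, hε, h1, h2, h3, h4, h5, h6⟩ : ∃ ε > 0, 2 * ε ≤ |S1.rep a - S1.rep b| ∧
      2 * ε ≤ |S1.rep b - S1.rep c| ∧ 2 * ε ≤ |S1.rep a - S1.rep c| ∧
      2 * ε ≤ 1 - S1.rep a ∧ 2 * ε ≤ 1 - S1.rep b ∧ 2 * ε ≤ 1 - S1.rep c := by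
    have k1 := abs_pos.2 (sub_ne_zero.2 hab')
    have k2 := abs_pos.2 (sub_ne_zero.2 hbc')
    have k3 := abs_pos.2 (sub_ne_zero.2 hac')
    have k : ∀ x y : ℝ, 0 < x → 0 < y → ∃ z > 0, z ≤ x ∧ z ≤ y := fun x y hx hy =>
      ⟨min x y, lt_min hx hy, min_le_left _ _, min_le_right _ _⟩
    obtain ⟨z1, p1, q1, r1⟩ := k _ _ k1 k2
    obtain ⟨z2, p2, q2, r2⟩ := k _ _ p1 k3
    obtain ⟨z3, p3, q3, r3⟩ := k _ (1 - S1.rep a) p2 (by linarith)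
    obtain ⟨z4, p4, q4, r4⟩ := k _ (1 - S1.rep b) p3 (by linarith)
    obtain ⟨z5, p5, q5, r5⟩ := k _ (1 - S1.rep c) p4 (by linarith)
    exact ⟨z5 / 2, by linarith, by linarith, by linarith, by linarith, by linarith,
      by linarith, by linarith⟩
  filter_upwards [(rep_near a ε hε).prod_mk ((rep_near b ε hε).prod_mk (rep_near c ε hε))]
  rintro ⟨x, y, z⟩ ⟨hx, hy, hz⟩
  dsimp only at hx hy hz ⊢
  have mx := rep_mem x
  have my := rep_mem y
  have mz := rep_mem z
  have cl : ∀ u v w : S1, circOrd u v w = if S1.rep u = S1.rep v ∨ S1.rep v = S1.rep w ∨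
      S1.rep u = S1.rep w then 0
      else if (S1.rep u < S1.rep v ∧ S1.rep v < S1.rep w) ∨
      (S1.rep v < S1.rep w ∧ S1.rep w < S1.rep u) ∨
      (S1.rep w < S1.rep u ∧ S1.rep u < S1.rep v) then 1 else -1 := by
    intro u v w
    have e : ∀ u v : S1, u = v ↔ S1.rep u = S1.rep v := fun u v => ⟨congrArg _, rep_inj⟩
    unfold circOrd
    simp only [e]
  rw [cl, cl]
  generalize S1.rep a = a at *
  generalize S1.rep b = b at *
  generalize S1.rep c = c at *
  generalize S1.rep x = x at *
  generalize S1.rep y = y at *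
  generalize S1.rep z = z at *
  clear cl
  rw [abs_lt] at hx hy hz
  rw [le_abs] at h1 h2 h3
  rcases hx with hx | hx <;> rcases hy with hy | hy <;> rcases hz with hz | hz <;>
  rcases h1 with h1 | h1 <;> rcases h2 with h2 | h2 <;> rcases h3 with h3 | h3 <;>
  first
  | (exfalso; linarith [hx.1, hx.2, hy.1, hy.2, hz.1, hz.2])
  | grind

theorem basepoint_convergence [Countable G]
    (ρ : G →* ↥HomeoPos) (x : S1) (hx : TrivialStabilizer ρ x)
    (xs : ℕ → S1) (hxs : ∀ i, TrivialStabilizer ρ (xs i))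
    (hlim : Filter.Tendsto xs Filter.atTop (nhds x)) :
    ∀ S : Finset G, ∃ N : ℕ, ∀ i ≥ N, ∀ g ∈ S, ∀ h ∈ S, ∀ k ∈ S,
      inducedCO ρ (xs i) g h k = inducedCO ρ x g h k := by
  intro S
  rw [← Filter.eventually_atTop]
  have inj : ∀ g h : G, ap (ρ g) x = ap (ρ h) x → g = h := by
    intro g h e
    have : ap (ρ (h⁻¹ * g)) x = x := by
      rw [map_mul, ap_mul, e, ← ap_mul, ← map_mul]
      simp [ap_one]
    exact (inv_mul_eq_one.1 (hx _ this)).symm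
  have lim : ∀ g : G, Filter.Tendsto (fun i => ap (ρ g) (xs i)) Filter.atTop
      (nhds (ap (ρ g) x)) := fun g => ((ρ g).2.1.tendsto x).comp hlim
  simp only [← Finset.mem_coe]
  rw [Filter.eventually_all_finite S.finite_toSet]
  intro g _
  rw [Filter.eventually_all_finite S.finite_toSet]
  intro h _
  rw [Filter.eventually_all_finite S.finite_toSet]
  intro k _
  by_cases hd : g = h ∨ h = k ∨ g = k
  · refine Filter.Eventually.of_forall fun i => ?_
    rcases hd with rfl | rfl | rfl <;> simp [inducedCO, circOrd]
  · push Not at hd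
    exact ((lim g).prodMk ((lim h).prodMk (lim k))).eventually
      (circOrd_near _ _ _ (fun e => hd.1 (inj _ _ e)) (fun e => hd.2.1 (inj _ _ e))
        (fun e => hd.2.2 (inj _ _ e)))

end
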